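/- Let a₁,…,a₆ be the edge lengths of a tetrahedron with faces (a₁,a₂,a₃), (a₃,a₄,a₅), (a₁,a₄,a₆), (a₂,a₅,a₆), and let ρ be its inradius. Then the sum over the four faces of [√(x²+y²)+√(y²+z²)+√(z²+x²)] is strictly less than (2+√2)·(a₁+⋯+a₆) − 12√3·(2−√2)·ρ. -/

import Mathlib

/-- Sum over one triangular face of the square-root expression. -/
noncomputable def faceSum (x y z : ℝ) : ℝ :=
  Real.sqrt (x ^ 2 + y ^ 2) + Real.sqrt (y ^ 2 + z ^ 2) + Real.sqrt (z ^ 2 + x ^ 2)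

/-- Area of a triangle with side lengths x, y, z, by Heron's formula. -/
noncomputable def heronArea (x y z : ℝ) : ℝ :=
  Real.sqrt (((x + y + z) / 2) * ((x + y + z) / 2 - x) * ((x + y + z) / 2 - y) *
    ((x + y + z) / 2 - z))


lemma poly_lo (t a b k c u v w s q A B C : ℝ) (ht : 0 ≤ t) (ha : 0 ≤ a) (hb : 0 ≤ b)
    (hk : k = 353/250 ∨ k = 3/2) (hc : c = 3/2 - k)
    (hw : w = t) (hv : v = t + a) (hu : u = t + a + b) (hs : s = u + v + w)
    (hq : q = u*v+v*w+w*u) (hA : A = s + u) (hB : B = s + v) (hC : C = s + w) :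
    0 ≤ (2*k-2)*( ((u-v)^2+(v-w)^2+(w-u)^2)*q*A*B^3*C^3
      + 2*s*((u-v)^2*w+(v-w)^2*u+(w-u)^2*v)*A*B^3*C^3)
      - 2*s*q*((v-w)^2*B^3*C^3+(u-w)^2*A*B^2*C^3+(u-v)^2*A*B^3*C^2)
      + 4*c*s*q*A*((u-w)^4*C^3+(u-v)^4*B^3) := by
  subst hA hB hC hq hs hw hv hu hc
  rcases hk with rfl | rfl
  · ring_nf
    positivity
  · ring_nf
    positivity

/-- Square root bound used for two of the pairs. -/
lemma sqrt_bound (x y t d k c : ℝ) (hk : k ^ 2 = 2) (hk1 : 1.412 < k) (hk2 : k < 1.5)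
    (hc : c = 3/2 - k)
    (ht : 0 < t) (hd : d ^ 2 ≤ t ^ 2) (hx : 2 * (x ^ 2 + y ^ 2) = t ^ 2 + d ^ 2) :
    k * Real.sqrt (x ^ 2 + y ^ 2) ≤ t + d ^ 2 / (2 * t) - c * d ^ 4 / t ^ 3 := by
  obtain ⟨e, he⟩ : ∃ e, e = d ^ 2 / t ^ 2 := ⟨_, rfl⟩
  have hde : d ^ 2 = e * t ^ 2 := by rw [he]; field_simp
  have he0 : 0 ≤ e := by rw [he]; positivity
  have he1 : e ≤ 1 := by rw [he]; exact (div_le_one (by positivity)).2 hd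
  have hc0 : 0 < c := by rw [hc]; linarith
  have hc1 : c < 0.088 := by rw [hc]; linarith
  have hcc : c ^ 2 - 3 * c + 1/4 = 0 := by rw [hc]; linear_combination hk
  have hr : t + d ^ 2 / (2 * t) - c * d ^ 4 / t ^ 3 = t * (1 + e/2 - c * e^2) := by
    have : d ^ 4 = (e * t^2)^2 := by rw [← hde]; ring
    rw [this, hde]; field_simp
  rw [hr]
  have hnn : 0 ≤ 1 + e/2 - c*e^2 := by nlinarith [mul_nonneg he0 (sub_nonneg.2 he1)]
  have h1 : k * Real.sqrt (x ^ 2 + y ^ 2) = Real.sqrt (t^2 * (1 + e)) := by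
    rw [show t^2 * (1+e) = k^2 * (x^2+y^2) by rw [hk, hx, hde]; ring,
      Real.sqrt_mul (by positivity), Real.sqrt_sq (by linarith)]
  rw [h1]
  apply Real.sqrt_le_iff.2 ⟨by positivity, ?_⟩
  rw [mul_pow]
  apply mul_le_mul_of_nonneg_left _ (by positivity)
  have h2 : (1 + e/2 - c*e^2)^2 - (1+e) = e^2 * ((1-e) * (1/4 - 2*c - c^2*e)) := by
    linear_combination (e^3) * hcc
  have h3 : 0 ≤ 1/4 - 2*c - c^2*e := by nlinarith
  have := mul_nonneg (sq_nonneg e) (mul_nonneg (sub_nonneg.2 he1) h3)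
  linarith

lemma sqrt_bound' (x y t d k : ℝ) (hk : k ^ 2 = 2) (hk1 : 1.412 < k)
    (ht : 0 < t) (hx : 2 * (x ^ 2 + y ^ 2) = t ^ 2 + d ^ 2) :
    k * Real.sqrt (x ^ 2 + y ^ 2) ≤ t + d ^ 2 / (2 * t) := by
  have h1 : k * Real.sqrt (x ^ 2 + y ^ 2) = Real.sqrt (t^2 + d^2) := by
    rw [← hx, ← hk, Real.sqrt_mul (by positivity), Real.sqrt_sq (by linarith)]
  rw [h1]
  apply Real.sqrt_le_iff.2 ⟨by positivity, ?_⟩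
  have : (t + d ^ 2 / (2 * t))^2 = t^2 + d^2 + (d ^ 2 / (2 * t))^2 := by field_simp; ring
  rw [this]; nlinarith [sq_nonneg (d ^ 2 / (2 * t))]

/-- Triangle inequality, ordered Ravi coordinates. -/
lemma tri_ord (u v w s H : ℝ) (hw : 0 < w) (hvw : w ≤ v) (huv : v ≤ u) (hs : s = u + v + w)
    (hH : H = Real.sqrt (s * u * v * w)) :
    Real.sqrt ((u+w)^2 + (u+v)^2) + Real.sqrt ((v+w)^2 + (u+v)^2)
      + Real.sqrt ((v+w)^2 + (u+w)^2) ≤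
    (2 + Real.sqrt 2) * s - 3 * Real.sqrt 3 * (2 - Real.sqrt 2) * (H / s) := by
  have hv : 0 < v := by linarith
  have hu : 0 < u := by linarith
  have hs0 : 0 < s := by linarith
  obtain ⟨k, hkd⟩ : ∃ k, k = Real.sqrt 2 := ⟨_, rfl⟩
  have hk : k ^ 2 = 2 := by rw [hkd]; exact Real.sq_sqrt (by norm_num)
  have hkp : 0 ≤ k := by rw [hkd]; positivity
  have hk1 : 1.412 < k := by nlinarith
  have hk2 : k < 1.5 := by nlinarith
  rw [← hkd]
  obtain ⟨q, hq⟩ : ∃ q, q = u*v+v*w+w*u := ⟨_, rfl⟩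
  have hq0 : 0 < q := by rw [hq]; positivity
  obtain ⟨c, hc⟩ : ∃ c, c = 3/2 - k := ⟨_, rfl⟩
  have b1 := sqrt_bound' (u+w) (u+v) (s+u) (v-w) k hk hk1 (by positivity) (by rw [hs]; ring)
  have b2 := sqrt_bound (v+w) (u+v) (s+v) (u-w) k c hk hk1 hk2 hc (by positivity)
    (by rw [hs]; nlinarith) (by rw [hs]; ring)
  have b3 := sqrt_bound (v+w) (u+w) (s+w) (u-v) k c hk hk1 hk2 hc (by positivity)
    (by rw [hs]; nlinarith) (by rw [hs]; ring)
  have hr : 3 * Real.sqrt 3 * (H / s) ≤ (9*(u*v*w)/q + 3*q/s)/2 := by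
    have e1 : 3 * Real.sqrt 3 * (H / s) = Real.sqrt (27 * (u*v*w) / s) := by
      rw [show 27 * (u*v*w) / s = (3/s)^2 * (3 * (s*u*v*w)) by field_simp; ring,
        Real.sqrt_mul (by positivity), Real.sqrt_sq (by positivity),
        Real.sqrt_mul (by norm_num), ← hH]
      ring
    rw [e1]
    apply Real.sqrt_le_iff.2 ⟨by positivity, ?_⟩
    have : ((9*(u*v*w)/q + 3*q/s)/2)^2 = 27 * (u*v*w) / s + ((9*(u*v*w)/q - 3*q/s)/2)^2 := by
      field_simp; ring
    rw [this]; nlinarith [sq_nonneg ((9*(u*v*w)/q - 3*q/s)/2)]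
  have N1 := poly_lo w (v-w) (u-v) (353/250) _ u v w s q (s+u) (s+v) (s+w) hw.le (by linarith)
    (by linarith) (Or.inl rfl) rfl rfl (by ring) (by ring) hs hq rfl rfl rfl
  have N2 := poly_lo w (v-w) (u-v) (3/2) _ u v w s q (s+u) (s+v) (s+w) hw.le (by linarith)
    (by linarith) (Or.inr rfl) rfl rfl (by ring) (by ring) hs hq rfl rfl rfl
  have N : 0 ≤ (2*k-2)*( ((u-v)^2+(v-w)^2+(w-u)^2)*q*(s+u)*(s+v)^3*(s+w)^3
      + 2*s*((u-v)^2*w+(v-w)^2*u+(w-u)^2*v)*(s+u)*(s+v)^3*(s+w)^3)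
      - 2*s*q*((v-w)^2*(s+v)^3*(s+w)^3+(u-w)^2*(s+u)*(s+v)^2*(s+w)^3
        +(u-v)^2*(s+u)*(s+v)^3*(s+w)^2)
      + 4*c*s*q*(s+u)*((u-w)^4*(s+w)^3+(u-v)^4*(s+v)^3) := by
    have M1 := mul_nonneg (show 0 ≤ (3/2 - k) / (3/2 - 353/250) by
      apply div_nonneg <;> norm_num at * <;> linarith) N1
    have M2 := mul_nonneg (show 0 ≤ (k - 353/250) / (3/2 - 353/250) by
      apply div_nonneg <;> norm_num at * <;> linarith) N2
    refine le_of_le_of_eq (add_nonneg M1 M2) ?_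
    rw [hc]
    generalize s + u = A
    generalize s + v = B
    generalize s + w = C
    ring
  have key : ((v-w)^2/(2*(s+u))) + ((u-w)^2/(2*(s+v)) - c*(u-w)^4/(s+v)^3)
      + ((u-v)^2/(2*(s+w)) - c*(u-v)^4/(s+w)^3)
      ≤ (2*k-2) * (s - (9*(u*v*w)/q + 3*q/s)/2) := by
    have hsum : s - (9*(u*v*w)/q + 3*q/s)/2 =
        (((u-v)^2+(v-w)^2+(w-u)^2)*q + 2*s*((u-v)^2*w+(v-w)^2*u+(w-u)^2*v)) / (4*s*q) := by
      field_simp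
      rw [hq, hs]; ring
    rw [hsum, ← sub_nonneg]
    have hA0 : 0 < s + u := by positivity
    have hB0 : 0 < s + v := by positivity
    have hC0 : 0 < s + w := by positivity
    generalize s + u = A at *
    generalize s + v = B at *
    generalize s + w = C at *
    refine le_of_le_of_eq (div_nonneg N (show 0 ≤ 4*s*q*A*B^3*C^3 by positivity)) ?_
    field_simp
    ring
  have hs2 : (s+u) + (s+v) + (s+w) = 4 * s := by rw [hs]; ring
  have hkk : k * (Real.sqrt ((u+w)^2 + (u+v)^2) + Real.sqrt ((v+w)^2 + (u+v)^2)
      + Real.sqrt ((v+w)^2 + (u+w)^2)) ≤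
      k * ((2 + k) * s - 3 * Real.sqrt 3 * (2 - k) * (H / s)) := by
    have e : k * ((2 + k) * s - 3 * Real.sqrt 3 * (2 - k) * (H / s)) =
        4 * s + (2*k-2) * (s - 3 * Real.sqrt 3 * (H / s)) := by
      linear_combination (s + 3 * Real.sqrt 3 * (H / s)) * hk
    rw [e]
    have := mul_le_mul_of_nonneg_left hr (show 0 ≤ 2*k-2 by linarith)
    linarith
  exact le_of_mul_le_mul_left hkk (by linarith)

lemma tri_ravi (u v w s H : ℝ) (hu : 0 < u) (hv : 0 < v) (hw : 0 < w) (hs : s = u + v + w)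
    (hH : H = Real.sqrt (s * u * v * w)) :
    faceSum (v+w) (u+w) (u+v) ≤
    (2 + Real.sqrt 2) * s - 3 * Real.sqrt 3 * (2 - Real.sqrt 2) * (H / s) := by
  unfold faceSum
  rcases le_total u v with h1 | h1 <;> rcases le_total v w with h2 | h2 <;>
    rcases le_total u w with h3 | h3
  · have := tri_ord w v u s H hu h1 h2 (by linarith) (by rw [hH]; congr 1; ring)
    convert this using 1; ring_nf
  · have := tri_ord w v u s H hu h1 h2 (by linarith) (by rw [hH]; congr 1; ring)
    convert this using 1; ring_nf
  · have := tri_ord v w u s H hu h3 h2 (by linarith) (by rw [hH]; congr 1; ring)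
    convert this using 1; ring_nf
  · have := tri_ord v u w s H hw h3 h1 (by linarith) (by rw [hH]; congr 1; ring)
    convert this using 1; ring_nf
  · have := tri_ord w u v s H hv h1 h3 (by linarith) (by rw [hH]; congr 1; ring)
    convert this using 1; ring_nf
  · have := tri_ord u w v s H hv h2 h3 (by linarith) (by rw [hH]; congr 1; ring)
    convert this using 1; ring_nf
  · have := tri_ord u v w s H hw h2 h1 (by linarith) (by rw [hH])
    convert this using 1; ring_nf
  · have := tri_ord u v w s H hw h2 h1 (by linarith) (by rw [hH])
    convert this using 1; ring_nf

/-- Triangle inequality with inradius `r = 2 F / P`. -/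
lemma tri (x y z : ℝ) (hx : x ≤ y + z) (hy : y ≤ x + z) (hz : z ≤ x + y)
    (hF : 0 < heronArea x y z) :
    faceSum x y z ≤ (1 + Real.sqrt 2 / 2) * (x + y + z)
      - 3 * Real.sqrt 3 * (2 - Real.sqrt 2) * (2 * heronArea x y z / (x + y + z)) := by
  have hp := Real.sqrt_pos.1 hF
  obtain ⟨u, hu⟩ : ∃ u, u = (x + y + z) / 2 - x := ⟨_, rfl⟩
  obtain ⟨v, hv⟩ : ∃ v, v = (x + y + z) / 2 - y := ⟨_, rfl⟩
  obtain ⟨w, hw⟩ : ∃ w, w = (x + y + z) / 2 - z := ⟨_, rfl⟩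
  obtain ⟨s, hs⟩ : ∃ s, s = (x + y + z) / 2 := ⟨_, rfl⟩
  have hH : heronArea x y z = Real.sqrt (s * u * v * w) := by
    unfold heronArea; rw [hu, hv, hw, hs]
  rw [← hu, ← hv, ← hw, ← hs] at hp
  have hu0 : u ≠ 0 := by rintro h; simp [h] at hp
  have hv0 : v ≠ 0 := by rintro h; simp [h] at hp
  have hw0 : w ≠ 0 := by rintro h; simp [h] at hp
  have hu1 : 0 < u := lt_of_le_of_ne (by linarith) hu0.symm
  have hv1 : 0 < v := lt_of_le_of_ne (by linarith) hv0.symm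
  have hw1 : 0 < w := lt_of_le_of_ne (by linarith) hw0.symm
  have := tri_ravi u v w s (heronArea x y z) hu1 hv1 hw1 (by linarith) hH
  have hs1 : 0 < s := by linarith
  rw [show v + w = x by linarith, show u + w = y by linarith, show u + v = z by linarith] at this
  rw [show x + y + z = 2 * s by linarith]
  convert this using 1
  field_simp

/-- Signed volume (times six). -/
def det4 (A B C D : EuclideanSpace ℝ (Fin 3)) : ℝ :=
  !![B 0 - A 0, B 1 - A 1, B 2 - A 2; C 0 - A 0, C 1 - A 1, C 2 - A 2;
    D 0 - A 0, D 1 - A 1, D 2 - A 2].det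

lemma dist3 (A B : EuclideanSpace ℝ (Fin 3)) :
    dist A B = Real.sqrt ((A 0 - B 0)^2 + (A 1 - B 1)^2 + (A 2 - B 2)^2) := by
  rw [EuclideanSpace.dist_eq]; simp [Fin.sum_univ_three, Real.dist_eq, sq_abs]

lemma dist3_sq (A B : EuclideanSpace ℝ (Fin 3)) :
    dist A B ^ 2 = (A 0 - B 0)^2 + (A 1 - B 1)^2 + (A 2 - B 2)^2 := by
  rw [dist3, Real.sq_sqrt (by positivity)]

lemma heron_tri (x y z G : ℝ) (h : 2*x^2*y^2 + 2*y^2*z^2+2*z^2*x^2 - x^4-y^4-z^4 = 4 * G) :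
    2 * heronArea x y z = Real.sqrt G := by
  unfold heronArea
  rw [show G = 2^2 * (((x + y + z) / 2) * ((x + y + z) / 2 - x) * ((x + y + z) / 2 - y) *
    ((x + y + z) / 2 - z)) by linear_combination (-1/4) * h,
    Real.sqrt_mul (show (0:ℝ) ≤ 2^2 by norm_num),
    Real.sqrt_sq (by norm_num)]

/-- The area of a triangle by the cross product. -/
lemma heron_cross (P Q X : EuclideanSpace ℝ (Fin 3)) (x y z : ℝ)
    (hx : x = dist P Q) (hy : y = dist P X) (hz : z = dist Q X) :
    2 * heronArea x y z = Real.sqrt (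
      ((Q 1 - P 1) * (X 2 - P 2) - (Q 2 - P 2) * (X 1 - P 1))^2 +
      ((Q 2 - P 2) * (X 0 - P 0) - (Q 0 - P 0) * (X 2 - P 2))^2 +
      ((Q 0 - P 0) * (X 1 - P 1) - (Q 1 - P 1) * (X 0 - P 0))^2) := by
  apply heron_tri
  have hx2 := dist3_sq P Q
  have hy2 := dist3_sq P X
  have hz2 := dist3_sq Q X
  rw [← hx] at hx2
  rw [← hy] at hy2
  rw [← hz] at hz2
  have : 2*x^2*y^2 + 2*y^2*z^2+2*z^2*x^2 - x^4-y^4-z^4 = 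
    2*x^2*y^2 + 2*y^2*z^2+2*z^2*x^2 - (x^2)^2-(y^2)^2-(z^2)^2 := by ring
  rw [this, hx2, hy2, hz2]; ring

lemma edge_bound (P Q X Y : EuclideanSpace ℝ (Fin 3)) (x y z y' z' : ℝ)
    (hx : x = dist P Q) (hy : y = dist P X) (hz : z = dist Q X)
    (hy' : y' = dist P Y) (hz' : z' = dist Q Y) :
    x * |det4 P Q X Y| ≤ (2 * heronArea x y z) * (2 * heronArea x y' z') := by
  rw [heron_cross P Q X x y z hx hy hz, heron_cross P Q Y x y' z' hx hy' hz', hx, dist3,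
    ← Real.sqrt_mul (by positivity), ← Real.sqrt_sq_eq_abs, ← Real.sqrt_mul (by positivity)]
  apply Real.sqrt_le_sqrt
  rw [← sub_nonneg]
  unfold det4
  rw [Matrix.det_fin_three]
  simp only [Matrix.of_apply, Matrix.cons_val', Matrix.cons_val_zero, Matrix.cons_val_one,
    Matrix.cons_val, Matrix.cons_val_fin_one]
  refine le_of_le_of_eq (sq_nonneg (
      ((Q 1 - P 1) * (X 2 - P 2) - (Q 2 - P 2) * (X 1 - P 1)) *
        ((Q 1 - P 1) * (Y 2 - P 2) - (Q 2 - P 2) * (Y 1 - P 1)) +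
      ((Q 2 - P 2) * (X 0 - P 0) - (Q 0 - P 0) * (X 2 - P 2)) *
        ((Q 2 - P 2) * (Y 0 - P 0) - (Q 0 - P 0) * (Y 2 - P 2)) +
      ((Q 0 - P 0) * (X 1 - P 1) - (Q 1 - P 1) * (X 0 - P 0)) *
        ((Q 0 - P 0) * (Y 1 - P 1) - (Q 1 - P 1) * (Y 0 - P 0)))) ?_
  rw [show P 0 - Q 0 = -(Q 0 - P 0) by ring, show P 1 - Q 1 = -(Q 1 - P 1) by ring,
    show P 2 - Q 2 = -(Q 2 - P 2) by ring]
  generalize Q 0 - P 0 = a0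
  generalize Q 1 - P 1 = a1
  generalize Q 2 - P 2 = a2
  generalize X 0 - P 0 = b0
  generalize X 1 - P 1 = b1
  generalize X 2 - P 2 = b2
  generalize Y 0 - P 0 = c0
  generalize Y 1 - P 1 = c1
  generalize Y 2 - P 2 = c2
  ring

lemma det4_expand (A B C D : EuclideanSpace ℝ (Fin 3)) : det4 A B C D =
    (B 0 - A 0) * ((C 1 - A 1) * (D 2 - A 2) - (C 2 - A 2) * (D 1 - A 1))
    - (B 1 - A 1) * ((C 0 - A 0) * (D 2 - A 2) - (C 2 - A 2) * (D 0 - A 0))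
    + (B 2 - A 2) * ((C 0 - A 0) * (D 1 - A 1) - (C 1 - A 1) * (D 0 - A 0)) := by
  unfold det4
  rw [Matrix.det_fin_three]
  simp only [Matrix.of_apply, Matrix.cons_val', Matrix.cons_val_zero, Matrix.cons_val_one,
    Matrix.cons_val, Matrix.cons_val_fin_one]
  ring

lemma det4_ne (A B C D : EuclideanSpace ℝ (Fin 3))
    (h : AffineIndependent ℝ ![A, B, C, D]) : det4 A B C D ≠ 0 := by
  intro h0
  obtain ⟨v, hv, hv0⟩ := Matrix.exists_vecMul_eq_zero_iff.2 h0
  rw [affineIndependent_iff] at h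
  have h' := h Finset.univ ![-(v 0 + v 1 + v 2), v 0, v 1, v 2]
    (by simp [Fin.sum_univ_four]; ring) (by
      have e0 := congrFun hv0 0
      have e1 := congrFun hv0 1
      have e2 := congrFun hv0 2
      simp [Matrix.vecMul, dotProduct, Fin.sum_univ_three] at e0 e1 e2
      ext i
      fin_cases i <;> simp [Fin.sum_univ_four] <;> linarith)
  apply hv
  have e0 := h' 1 (Finset.mem_univ _)
  have e1 := h' 2 (Finset.mem_univ _)
  have e2 := h' 3 (Finset.mem_univ _)
  simp at e0 e1 e2
  ext i
  fin_cases i <;> simp [e0, e1, e2]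

/-- Volume of the corner simplex. -/
lemma corner_vol (n : ℕ) : ∀ c : ℝ, 0 ≤ c →
    MeasureTheory.volume {x : Fin n → ℝ | (∀ i, 0 ≤ x i) ∧ ∑ i, x i ≤ c}
      ≤ ENNReal.ofReal (c ^ n / n.factorial) := by
  induction n with
  | zero =>
    intro c hc
    refine (MeasureTheory.measure_mono (Set.subset_univ _)).trans ?_
    simp [MeasureTheory.volume_pi]
  | succ n ih =>
    intro c hc
    set T := {x : Fin (n+1) → ℝ | (∀ i, 0 ≤ x i) ∧ ∑ i, x i ≤ c} with hT
    have hTm : MeasurableSet T := by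
      apply IsClosed.measurableSet
      rw [hT, Set.ofPred_and]
      apply IsClosed.inter
      · rw [Set.ofPred_forall]
        exact isClosed_iInter fun i => isClosed_le continuous_const (continuous_apply i)
      · exact isClosed_le (by fun_prop) continuous_const
    have mp := (MeasureTheory.volume_preserving_piFinSuccAbove (fun _ : Fin (n+1) => ℝ) 0).symm
    rw [← mp.measure_preimage hTm.nullMeasurableSet,
      MeasureTheory.Measure.volume_eq_prod, MeasureTheory.Measure.prod_apply
        (mp.measurable hTm)]
    have hle : ∀ x : ℝ, MeasureTheory.volume (Prod.mk x ⁻¹'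
        ((MeasurableEquiv.piFinSuccAbove (fun _ : Fin (n+1) => ℝ) 0).symm ⁻¹' T)) ≤
        (Set.Icc 0 c).indicator (fun x => ENNReal.ofReal ((c - x) ^ n / n.factorial)) x := by
      intro x
      by_cases hx : x ∈ Set.Icc 0 c
      · rw [Set.indicator_of_mem hx]
        refine le_trans (MeasureTheory.measure_mono ?_) (ih (c - x) (by linarith [hx.2]))
        intro y hy
        simp [hT, MeasurableEquiv.piFinSuccAbove, Fin.sum_univ_succ, Fin.forall_fin_succ] at hy
        exact ⟨hy.1.2, by linarith [hy.2]⟩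
      · rw [Set.indicator_of_notMem hx]
        apply le_of_eq
        refine (congrArg _ ?_).trans (MeasureTheory.measure_empty (μ := MeasureTheory.volume))
        ext y
        simp [hT, MeasurableEquiv.piFinSuccAbove, Fin.sum_univ_succ, Fin.forall_fin_succ]
        intro h1 h2
        by_contra! h3
        apply hx
        exact ⟨h1, by linarith [Finset.sum_nonneg fun i (_ : i ∈ Finset.univ) => h2 i]⟩
    refine (MeasureTheory.lintegral_mono hle).trans ?_
    rw [MeasureTheory.lintegral_indicator measurableSet_Icc,
      ← MeasureTheory.ofReal_integral_eq_lintegral_ofReal]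
    · apply ENNReal.ofReal_le_ofReal
      rw [MeasureTheory.integral_Icc_eq_integral_Ioc, ← intervalIntegral.integral_of_le hc,
        intervalIntegral.integral_comp_sub_left (fun x => x ^ n / (n.factorial : ℝ)),
        intervalIntegral.integral_div, integral_pow, Nat.factorial_succ]
      apply le_of_eq
      push_cast
      simp
      field_simp
    · apply Continuous.integrableOn_Icc; fun_prop
    · filter_upwards [MeasureTheory.ae_restrict_mem measurableSet_Icc] with x hx
      have : 0 ≤ c - x := by linarith [hx.2]
      simp only [Pi.zero_apply]
      positivity

lemma vol_bound (A B C D : EuclideanSpace ℝ (Fin 3)) :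
    (MeasureTheory.volume (convexHull ℝ {A, B, C, D})).toReal ≤ |det4 A B C D| / 6 := by
  set M := !![B 0 - A 0, B 1 - A 1, B 2 - A 2; C 0 - A 0, C 1 - A 1, C 2 - A 2;
    D 0 - A 0, D 1 - A 1, D 2 - A 2] with hM
  set T := {x : Fin 3 → ℝ | (∀ i, 0 ≤ x i) ∧ ∑ i, x i ≤ 1} with hT
  have hTc : Convex ℝ T := by
    intro x hx y hy a b ha hb hab
    refine ⟨fun i => ?_, ?_⟩
    · have := hx.1 i
      have := hy.1 i
      simp only [Pi.add_apply, Pi.smul_apply, smul_eq_mul]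
      positivity
    · have h1 := hx.2
      have h2 := hy.2
      simp only [Pi.add_apply, Pi.smul_apply, smul_eq_mul, Finset.sum_add_distrib,
        ← Finset.mul_sum]
      nlinarith
  let e := MeasurableEquiv.toLp 2 (Fin 3 → ℝ)
  set U : Set (Fin 3 → ℝ) := (fun x => -(WithLp.ofLp A) + x) ⁻¹' (Matrix.toLin' M.transpose '' T) with hU
  have hUc : Convex ℝ U := (hTc.linear_image (Matrix.toLin' M.transpose)).translate_preimage_right _
  have hsub : convexHull ℝ {A, B, C, D} ⊆ e.symm ⁻¹' U := by
    apply convexHull_min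
    · have key : ∀ (X : EuclideanSpace ℝ (Fin 3)) (y : Fin 3 → ℝ), y ∈ T →
          Matrix.toLin' M.transpose y = -(WithLp.ofLp A) + WithLp.ofLp X → X ∈ e.symm ⁻¹' U := 
        fun X y hy h => ⟨y, hy, h⟩
      rintro X (rfl | rfl | rfl | rfl)
      · apply key _ 0
        · simp [hT]
        · simp
      · apply key _ ![1,0,0]
        · simp [hT, Fin.sum_univ_three, Fin.forall_fin_succ]
        · ext i; fin_cases i <;> simp [hM, Matrix.mulVec, dotProduct, Fin.sum_univ_three] <;> ring
      · apply key _ ![0,1,0]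
        · simp [hT, Fin.sum_univ_three, Fin.forall_fin_succ]
        · ext i; fin_cases i <;> simp [hM, Matrix.mulVec, dotProduct, Fin.sum_univ_three] <;> ring
      · apply key _ ![0,0,1]
        · simp [hT, Fin.sum_univ_three, Fin.forall_fin_succ]
        · ext i; fin_cases i <;> simp [hM, Matrix.mulVec, dotProduct, Fin.sum_univ_three] <;> ring
    · exact hUc.linear_preimage (WithLp.linearEquiv 2 ℝ (Fin 3 → ℝ)).toLinearMap
  have hvol : MeasureTheory.volume (convexHull ℝ {A, B, C, D}) ≤
      ENNReal.ofReal (|det4 A B C D| / 6) := by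
    refine (MeasureTheory.measure_mono hsub).trans ?_
    rw [(EuclideanSpace.volume_preserving_symm_measurableEquiv_toLp (Fin 3)).measure_preimage_equiv,
      hU, MeasureTheory.measure_preimage_add, MeasureTheory.Measure.addHaar_image_linearMap,
      LinearMap.det_toLin', Matrix.det_transpose]
    refine (mul_le_mul_right (corner_vol 3 1 zero_le_one) _).trans ?_
    rw [← ENNReal.ofReal_mul (abs_nonneg _)]
    apply ENNReal.ofReal_le_ofReal
    apply le_of_eq
    change |det4 A B C D| * _ = _
    norm_num [Nat.factorial]
    ring
  exact ENNReal.toReal_le_of_le_ofReal (by positivity) hvol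

lemma heron_nonneg (x y z : ℝ) : 0 ≤ heronArea x y z := Real.sqrt_nonneg _

lemma heron_swap (x y z : ℝ) : heronArea x y z = heronArea y x z := by
  unfold heronArea; congr 1; ring

lemma heron_rot (x y z : ℝ) : heronArea x y z = heronArea y z x := by
  unfold heronArea; congr 1; ring

/-- The inradius is smaller than the inradius of each face. -/
lemma rho_lt (x y z d V F F1 F2 F3 S : ℝ) (hP : 0 < x + y + z)
    (hV : V ≤ d / 6) (hF : 0 < F) (h1 : 0 ≤ F1) (h2 : 0 ≤ F2) (h3 : 0 ≤ F3)
    (e1 : x * d ≤ (2*F)*(2*F1)) (e2 : y * d ≤ (2*F)*(2*F2)) (e3 : z * d ≤ (2*F)*(2*F3))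
    (hS : S = F + F1 + F2 + F3) : 3 * V / S < 2 * F / (x + y + z) := by
  have hS0 : 0 < S := by linarith
  rw [div_lt_div_iff₀ hS0 hP, hS]
  have := mul_le_mul_of_nonneg_right hV hP.le
  nlinarith [mul_pos hF hF]

set_option maxHeartbeats 2000000 in
theorem stmt_8 (A B C D : EuclideanSpace ℝ (Fin 3))
    (hABCD : AffineIndependent ℝ ![A, B, C, D])
    (a₁ a₂ a₃ a₄ a₅ a₆ V S ρ : ℝ)
    (h1 : a₁ = dist A B) (h2 : a₂ = dist B C) (h3 : a₃ = dist C A)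
    (h4 : a₄ = dist A D) (h5 : a₅ = dist D C) (h6 : a₆ = dist B D)
    (hV : V = (MeasureTheory.volume (convexHull ℝ {A, B, C, D})).toReal)
    (hS : S = heronArea a₁ a₂ a₃ + heronArea a₃ a₄ a₅ + heronArea a₁ a₄ a₆ +
        heronArea a₂ a₅ a₆)
    (hρ : ρ = 3 * V / S) :
    faceSum a₁ a₂ a₃ + faceSum a₃ a₄ a₅ + faceSum a₁ a₄ a₆ + faceSum a₂ a₅ a₆ <
      (2 + Real.sqrt 2) * (a₁ + a₂ + a₃ + a₄ + a₅ + a₆) -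
        12 * Real.sqrt 3 * (2 - Real.sqrt 2) * ρ := by
  have hd := det4_ne A B C D hABCD
  have hvb := vol_bound A B C D
  rw [← hV] at hvb
  obtain ⟨d, hdd⟩ : ∃ d, d = |det4 A B C D| := ⟨_, rfl⟩
  rw [← hdd] at hvb
  have hd0 : 0 < d := by rw [hdd]; exact abs_pos.2 hd
  have h1' : a₁ = dist B A := by rw [h1, dist_comm]
  have h2' : a₂ = dist C B := by rw [h2, dist_comm]
  have h3' : a₃ = dist A C := by rw [h3, dist_comm]
  have h4' : a₄ = dist D A := by rw [h4, dist_comm]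
  have h5' : a₅ = dist C D := by rw [h5, dist_comm]
  have h6' : a₆ = dist D B := by rw [h6, dist_comm]
  have hne : ∀ i j : Fin 4, i ≠ j → ![A, B, C, D] i ≠ ![A, B, C, D] j :=
    fun i j hij h => hij (hABCD.injective h)
  have p1 : 0 < a₁ := by rw [h1]; exact dist_pos.2 (hne 0 1 (by decide))
  have p2 : 0 < a₂ := by rw [h2]; exact dist_pos.2 (hne 1 2 (by decide))
  have p3 : 0 < a₃ := by rw [h3]; exact dist_pos.2 (hne 2 0 (by decide))
  have p4 : 0 < a₄ := by rw [h4]; exact dist_pos.2 (hne 0 3 (by decide))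
  have p5 : 0 < a₅ := by rw [h5]; exact dist_pos.2 (hne 3 2 (by decide))
  have p6 : 0 < a₆ := by rw [h6]; exact dist_pos.2 (hne 1 3 (by decide))
  obtain ⟨F1, hF1⟩ : ∃ F, F = heronArea a₁ a₂ a₃ := ⟨_, rfl⟩
  obtain ⟨F2, hF2⟩ : ∃ F, F = heronArea a₃ a₄ a₅ := ⟨_, rfl⟩
  obtain ⟨F3, hF3⟩ : ∃ F, F = heronArea a₁ a₄ a₆ := ⟨_, rfl⟩
  obtain ⟨F4, hF4⟩ : ∃ F, F = heronArea a₂ a₅ a₆ := ⟨_, rfl⟩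
  have n1 : 0 ≤ F1 := hF1 ▸ heron_nonneg _ _ _
  have n2 : 0 ≤ F2 := hF2 ▸ heron_nonneg _ _ _
  have n3 : 0 ≤ F3 := hF3 ▸ heron_nonneg _ _ _
  have n4 : 0 ≤ F4 := hF4 ▸ heron_nonneg _ _ _
  have E1 : a₁ * d ≤ (2*F1)*(2*F3) := by
    have := edge_bound A B C D a₁ a₃ a₂ a₄ a₆ h1 h3' h2 h4 h6
    rw [← hdd] at this
    rw [hF1, hF3]
    convert this using 3
    unfold heronArea; congr 1; ring
  have E2 : a₂ * d ≤ (2*F1)*(2*F4) := by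
    have := edge_bound B C A D a₂ a₁ a₃ a₆ a₅ h2 h1' h3 h6 h5'
    rw [show det4 B C A D = det4 A B C D by rw [det4_expand, det4_expand]; ring, ← hdd] at this
    rw [hF1, hF4]
    convert this using 3
    · unfold heronArea; congr 1; ring
    · unfold heronArea; congr 1; ring
  have E3 : a₃ * d ≤ (2*F1)*(2*F2) := by
    have := edge_bound C A B D a₃ a₂ a₁ a₅ a₄ h3 h2' h1 h5' h4
    rw [show det4 C A B D = det4 A B C D by rw [det4_expand, det4_expand]; ring, ← hdd] at this
    rw [hF1, hF2]
    convert this using 3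
    · unfold heronArea; congr 1; ring
    · unfold heronArea; congr 1; ring
  have E4 : a₄ * d ≤ (2*F2)*(2*F3) := by
    have := edge_bound A D C B a₄ a₃ a₅ a₁ a₆ h4 h3' h5 h1 h6'
    rw [show det4 A D C B = -det4 A B C D by rw [det4_expand, det4_expand]; ring, abs_neg,
      ← hdd] at this
    rw [hF2, hF3]
    convert this using 3
    · unfold heronArea; congr 1; ring
    · unfold heronArea; congr 1; ring
  have E5 : a₅ * d ≤ (2*F2)*(2*F4) := by
    have := edge_bound D C A B a₅ a₄ a₃ a₆ a₂ h5 h4' h3 h6' h2'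
    rw [show det4 D C A B = -det4 A B C D by rw [det4_expand, det4_expand]; ring, abs_neg,
      ← hdd] at this
    rw [hF2, hF4]
    convert this using 3
    · unfold heronArea; congr 1; ring
    · unfold heronArea; congr 1; ring
  have E6 : a₆ * d ≤ (2*F3)*(2*F4) := by
    have := edge_bound B D A C a₆ a₁ a₄ a₂ a₅ h6 h1' h4' h2 h5
    rw [show det4 B D A C = -det4 A B C D by rw [det4_expand, det4_expand]; ring, abs_neg,
      ← hdd] at this
    rw [hF3, hF4]
    convert this using 3
    · unfold heronArea; congr 1; ring
    · unfold heronArea; congr 1; ring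
  have q1 : 0 < F1 := by
    rcases n1.lt_or_eq with h | h
    · exact h
    · rw [← h] at E1; nlinarith [mul_pos p1 hd0]
  have q3 : 0 < F3 := by
    rcases n3.lt_or_eq with h | h
    · exact h
    · rw [← h] at E1; nlinarith [mul_pos p1 hd0]
  have q2 : 0 < F2 := by
    rcases n2.lt_or_eq with h | h
    · exact h
    · rw [← h] at E3; nlinarith [mul_pos p3 hd0]
  have q4 : 0 < F4 := by
    rcases n4.lt_or_eq with h | h
    · exact h
    · rw [← h] at E2; nlinarith [mul_pos p2 hd0]
  rw [← hF1, ← hF2, ← hF3, ← hF4] at hS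
  have r1 := rho_lt a₁ a₂ a₃ d V F1 F3 F4 F2 S (by positivity) hvb q1 n3 n4 n2 E1 E2 E3
    (by linarith)
  have r2 := rho_lt a₃ a₄ a₅ d V F2 F1 F3 F4 S (by positivity) hvb q2 n1 n3 n4
    (by linarith) E4 E5 (by linarith)
  have r3 := rho_lt a₁ a₄ a₆ d V F3 F1 F2 F4 S (by positivity) hvb q3 n1 n2 n4
    (by linarith) (by linarith) E6 (by linarith)
  have r4 := rho_lt a₂ a₅ a₆ d V F4 F1 F2 F3 S (by positivity) hvb q4 n1 n2 n3
    (by linarith) (by linarith) (by linarith) (by linarith)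
  rw [← hρ] at r1 r2 r3 r4
  have t1 := tri a₁ a₂ a₃
    (by rw [h1, h2', h3]; linarith [dist_triangle A C B, dist_comm A C])
    (by rw [h1', h2, h3']; linarith [dist_triangle B A C])
    (by rw [h1', h2', h3]; linarith [dist_triangle C B A]) (hF1 ▸ q1)
  have t2 := tri a₃ a₄ a₅
    (by rw [h3', h4, h5]; linarith [dist_triangle A D C])
    (by rw [h3', h4, h5']; linarith [dist_triangle A C D])
    (by rw [h3', h4', h5]; linarith [dist_triangle D A C]) (hF2 ▸ q2)
  have t3 := tri a₁ a₄ a₆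
    (by rw [h1, h4, h6']; linarith [dist_triangle A D B])
    (by rw [h1, h4, h6]; linarith [dist_triangle A B D])
    (by rw [h1', h4, h6]; linarith [dist_triangle B A D]) (hF3 ▸ q3)
  have t4 := tri a₂ a₅ a₆
    (by rw [h2, h5, h6]; linarith [dist_triangle B D C])
    (by rw [h2, h5, h6']; linarith [dist_triangle D B C])
    (by rw [h2, h5', h6]; linarith [dist_triangle B C D]) (hF4 ▸ q4)
  rw [← hF1] at t1
  rw [← hF2] at t2
  rw [← hF3] at t3
  rw [← hF4] at t4
  have hk : 0 < 3 * Real.sqrt 3 * (2 - Real.sqrt 2) := by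
    have : Real.sqrt 2 < 2 := by
      rw [Real.sqrt_lt' (by norm_num)]; norm_num
    have h3 : 0 < Real.sqrt 3 := by positivity
    have : 0 < 2 - Real.sqrt 2 := by linarith
    positivity
  have m1 := mul_lt_mul_of_pos_left r1 hk
  have m2 := mul_lt_mul_of_pos_left r2 hk
  have m3 := mul_lt_mul_of_pos_left r3 hk
  have m4 := mul_lt_mul_of_pos_left r4 hk
  linarith
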